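/- Identify ℝ² with ℂ and let B² = {z ∈ ℂ : |z| < 1}. For a ∈ B² and θ ∈ ℝ let f(z) = e^{iθ}·(z−a)/(1−\bar{a}·z), which is a Möbius transformation of B² onto itself. Then for all x,y ∈ B², v_{B²}(f(x),f(y)) ≤ 2·v_{B²}(x,y); moreover the constant 2 is best possible over all such maps: for every c < 2 there exist a ∈ B², θ ∈ ℝ and distinct x,y ∈ B² with v_{B²}(f(x),f(y)) > c·v_{B²}(x,y). -/

import Mathlib

open EuclideanGeometry Real Set

/-- The visual angle metric on a planar domain `G ⊊ ℂ`:
`v_G(x,y) = sup_{z ∈ ∂G} ∠(x,z,y)`. -/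
noncomputable def visualAngleC (G : Set ℂ) (x y : ℂ) : ℝ :=
  sSup ((fun z => EuclideanGeometry.angle x z y) '' frontier G)

/-- The Möbius transformation `z ↦ e^{iθ}(z−a)/(1−\bar a z)` of the unit disc onto itself. -/
noncomputable def discMoebius (a : ℂ) (θ : ℝ) (z : ℂ) : ℂ :=
  Complex.exp (θ * Complex.I) * (z - a) / (1 - (starRingEnd ℂ) a * z)

section Norm

variable {E : Type*} [NormedAddCommGroup E]

/-- The quantity `sinh (ρ/2)`, where `ρ` is the hyperbolic distance in the unit ball. -/
noncomputable def sinhHalfDist (x y : E) : ℝ :=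
  ‖x - y‖ / √((1 - ‖x‖ ^ 2) * (1 - ‖y‖ ^ 2))

lemma one_sub_norm_sq_pos {x : E} (hx : ‖x‖ < 1) : 0 < 1 - ‖x‖ ^ 2 := by
  nlinarith [norm_nonneg x]

lemma sinhHalfDist_nonneg (x y : E) : 0 ≤ sinhHalfDist x y := by
  unfold sinhHalfDist; positivity

lemma sinhHalfDist_sq {x y : E} (hx : ‖x‖ < 1) (hy : ‖y‖ < 1) :
    sinhHalfDist x y ^ 2 = ‖x - y‖ ^ 2 / ((1 - ‖x‖ ^ 2) * (1 - ‖y‖ ^ 2)) := by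
  unfold sinhHalfDist
  rw [div_pow, Real.sq_sqrt]
  exact (mul_pos (one_sub_norm_sq_pos hx) (one_sub_norm_sq_pos hy)).le

end Norm

section InnerProduct

variable {E : Type*} [NormedAddCommGroup E] [InnerProductSpace ℝ E]

lemma two_mul_inner_mul_inner_le {z : E} (hz : ‖z‖ = 1) (u v : E) :
    2 * (inner ℝ z u * inner ℝ z v) ≤ ‖u‖ * ‖v‖ + inner ℝ u v := by
  have hn : ‖(2 * inner ℝ z u) • z - u‖ = ‖u‖ := by
    rw [← sq_eq_sq₀ (norm_nonneg _) (norm_nonneg _), norm_sub_sq_real, norm_smul,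
      real_inner_smul_left, hz, mul_one, Real.norm_eq_abs, sq_abs]
    ring
  have h := real_inner_le_norm ((2 * inner ℝ z u) • z - u) v
  rw [hn, inner_sub_left, real_inner_smul_left] at h
  linarith

lemma angle_le_two_mul_arctan {x y z : E} (hx : ‖x‖ < 1) (hy : ‖y‖ < 1) (hz : ‖z‖ = 1) :
    EuclideanGeometry.angle x z y ≤ 2 * Real.arctan (sinhHalfDist x y) := by
  have hS := sinhHalfDist_nonneg x y
  have hP := one_sub_norm_sq_pos hx
  have hQ := one_sub_norm_sq_pos hy
  have hA : 0 < ‖x - z‖ := norm_pos_iff.2 (sub_ne_zero.2 fun h => by subst h; linarith)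
  have hB : 0 < ‖y - z‖ := norm_pos_iff.2 (sub_ne_zero.2 fun h => by subst h; linarith)
  have h0 : 0 ≤ 2 * Real.arctan (sinhHalfDist x y) := by
    have := Real.arctan_nonneg.2 hS
    linarith
  have hpi : 2 * Real.arctan (sinhHalfDist x y) ≤ π := by
    linarith [Real.arctan_lt_pi_div_two (sinhHalfDist x y)]
  rw [← Real.arccos_cos h0 hpi]
  unfold EuclideanGeometry.angle InnerProductGeometry.angle
  simp only [vsub_eq_sub]
  apply Real.arccos_le_arccos
  rw [Real.cos_two_mul, Real.cos_sq_arctan, sinhHalfDist_sq hx hy]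
  obtain ⟨u, rfl⟩ : ∃ u, x = z + u := ⟨x - z, by abel⟩
  obtain ⟨v, rfl⟩ : ∃ v, y = z + v := ⟨y - z, by abel⟩
  have hbuz := two_mul_inner_mul_inner_le hz u v
  have hcs := real_inner_le_norm u v
  have hnx := norm_add_sq_real z u
  have hny := norm_add_sq_real z v
  have hd := norm_sub_sq_real u v
  simp only [add_sub_cancel_left, add_sub_add_left_eq_sub] at *
  rw [hz] at hnx hny
  set A := ‖u‖
  set B := ‖v‖
  set c : ℝ := inner ℝ u v
  set s : ℝ := inner ℝ z u
  set t : ℝ := inner ℝ z v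
  set P := 1 - ‖z + u‖ ^ 2
  set Q := 1 - ‖z + v‖ ^ 2
  set D := ‖u - v‖
  have hPQ : P * Q ≤ 2 * (A * B + c) := by
    have : P * Q ≤ (-2 * s) * (-2 * t) :=
      mul_le_mul (by nlinarith) (by nlinarith) hQ.le (by nlinarith)
    linarith
  have hD : 2 * (A * B - c) ≤ D ^ 2 := by nlinarith [sq_nonneg (A - B)]
  have hPQ0 := mul_pos hP hQ
  have key : 2 * (P * Q) / (P * Q + D ^ 2) ≤ (c + A * B) / (A * B) := by
    rw [div_le_div_iff₀ (by positivity) (by positivity)]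
    have h1 : (A * B - c) * (P * Q) ≤ (A * B - c) * (2 * (A * B + c)) :=
      mul_le_mul_of_nonneg_left hPQ (by linarith)
    have h2 : (A * B + c) * (2 * (A * B - c)) ≤ (A * B + c) * D ^ 2 :=
      mul_le_mul_of_nonneg_left hD (by linarith)
    nlinarith
  have e1 : 2 * (1 / (1 + D ^ 2 / (P * Q))) = 2 * (P * Q) / (P * Q + D ^ 2) := by
    field_simp
  have e2 : (c + A * B) / (A * B) = c / (A * B) + 1 := by
    field_simp
  linarith

end InnerProduct

lemma exists_norm_eq_one_re_mul_conj (w : ℂ) :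
    ∃ z : ℂ, ‖z‖ = 1 ∧ z.re * w.re + z.im * w.im = ‖w‖ := by
  by_cases hw : w = 0
  · exact ⟨1, by simp, by simp [hw]⟩
  · have hn : ‖w‖ ≠ 0 := norm_ne_zero_iff.2 hw
    refine ⟨w / (‖w‖ : ℂ), by simp [hn], ?_⟩
    rw [Complex.div_ofReal_re, Complex.div_ofReal_im]
    field_simp
    rw [Complex.sq_norm, Complex.normSq_apply]
    ring

lemma inner_eq_re_im (u v : ℂ) : inner ℝ u v = u.re * v.re + u.im * v.im := by
  rw [Complex.inner]
  simp [mul_comm]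

lemma norm_sq_eq_re_im (u : ℂ) : ‖u‖ ^ 2 = u.re ^ 2 + u.im ^ 2 := by
  rw [Complex.sq_norm, Complex.normSq_apply]
  ring

/-- Some boundary point sees `x` and `y` under an angle whose tangent is at least
`sinhHalfDist x y` (or under a non-acute angle). -/
lemma exists_sinhHalfDist_mul_inner_le {x y : ℂ} (hx : ‖x‖ < 1) (hy : ‖y‖ < 1) :
    ∃ z : ℂ, ‖z‖ = 1 ∧ sinhHalfDist x y * inner ℝ (x - z) (y - z) ≤
      |(x - z).re * (y - z).im - (x - z).im * (y - z).re| := by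
  have hP := one_sub_norm_sq_pos hx
  have hQ := one_sub_norm_sq_pos hy
  have hPQ := mul_pos hP hQ
  set R := √((1 - ‖x‖ ^ 2) * (1 - ‖y‖ ^ 2))
  have hR : 0 < R := Real.sqrt_pos.2 hPQ
  have hR2 : R ^ 2 = (1 - ‖x‖ ^ 2) * (1 - ‖y‖ ^ 2) := Real.sq_sqrt hPQ.le
  set D := ‖x - y‖
  have hD : 0 ≤ D := norm_nonneg _
  have hD2 : D ^ 2 = (x - y).re ^ 2 + (x - y).im ^ 2 := norm_sq_eq_re_im _
  rw [norm_sq_eq_re_im, norm_sq_eq_re_im] at hR2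
  rw [norm_sq_eq_re_im] at hP hQ
  simp only [Complex.sub_re, Complex.sub_im] at hD2 ⊢
  set k := x.re * y.im - x.im * y.re
  set m := x.re * y.re + x.im * y.im
  have hkD : k ^ 2 ≤ D ^ 2 := by
    have : k ^ 2 + (x.re * (y.re - x.re) + x.im * (y.im - x.im)) ^ 2 =
        (x.re ^ 2 + x.im ^ 2) * D ^ 2 := by
      rw [hD2]; ring
    nlinarith [sq_nonneg (x.re * (y.re - x.re) + x.im * (y.im - x.im)), sq_nonneg D]
  have hm1 : 0 ≤ 1 - m := by
    nlinarith [sq_nonneg (x.re - y.re), sq_nonneg (x.im - y.im)]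
  have hRm : R ≤ 1 - m := by
    refine abs_le_of_sq_le_sq' ?_ hm1 |>.2
    have : R ^ 2 + D ^ 2 = (1 - m) ^ 2 + k ^ 2 := by rw [hR2, hD2]; ring
    linarith
  have hkD' : |k| ≤ D := abs_le_of_sq_le_sq hkD hD
  obtain ⟨ε, hε, hεk⟩ : ∃ ε : ℝ, |ε| = 1 ∧ ε * k = -|k| := by
    rcases le_total 0 k with h | h
    · exact ⟨-1, by simp, by rw [abs_of_nonneg h]; ring⟩
    · exact ⟨1, by simp, by rw [abs_of_nonpos h]; ring⟩
  have hε2 : ε ^ 2 = 1 := by rw [← sq_abs, hε]; norm_num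
  obtain ⟨z, hz, hzw⟩ := exists_norm_eq_one_re_mul_conj
    ⟨D * (x.re + y.re) + ε * R * (x.im - y.im), D * (x.im + y.im) - ε * R * (x.re - y.re)⟩
  have hw2 := norm_sq_eq_re_im
    ⟨D * (x.re + y.re) + ε * R * (x.im - y.im), D * (x.im + y.im) - ε * R * (x.re - y.re)⟩
  simp only at hzw hw2
  set W := ‖(⟨D * (x.re + y.re) + ε * R * (x.im - y.im),
    D * (x.im + y.im) - ε * R * (x.re - y.re)⟩ : ℂ)‖
  have hW0 : 0 ≤ W := norm_nonneg _
  have hdiff : W ^ 2 - (ε * R * k - D * (1 + m)) ^ 2 =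
      k ^ 2 * (D ^ 2 - R ^ 2) - 2 * D * R * (ε * k) * (1 - m) := by
    have e1 : W ^ 2 = D ^ 2 * ((x.re + y.re) ^ 2 + (x.im + y.im) ^ 2) +
        ε ^ 2 * R ^ 2 * ((x.re - y.re) ^ 2 + (x.im - y.im) ^ 2) - 4 * D * R * (ε * k) := by
      rw [hw2]; ring
    have e2 : (x.re + y.re) ^ 2 + (x.im + y.im) ^ 2 + R ^ 2 - (1 + m) ^ 2 = k ^ 2 := by
      rw [hR2]; ring
    rw [e1, ← hD2, hε2]
    linear_combination D ^ 2 * e2 - R ^ 2 * k ^ 2 * hε2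
  have hsq : (ε * R * k - D * (1 + m)) ^ 2 ≤ W ^ 2 := by
    rw [hεk] at hdiff
    have h1 : R * |k| ≤ (1 - m) * D := mul_le_mul hRm hkD' (abs_nonneg _) hm1
    have h2 : 0 ≤ R * |k| * ((1 - m) * D - R * |k|) :=
      mul_nonneg (by positivity) (by linarith)
    have h3 : 0 ≤ D * R * |k| * (1 - m) := by positivity
    have h4 : 0 ≤ |k| ^ 2 * D ^ 2 := by positivity
    rw [← sq_abs k] at hdiff
    nlinarith
  have hge : 0 ≤ ε * R * k - D * (1 + m) + W := by
    linarith [(abs_le_of_sq_le_sq' hsq hW0).1]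
  refine ⟨z, hz, ?_⟩
  have hz2 := norm_sq_eq_re_im z
  rw [hz] at hz2
  have hS : sinhHalfDist x y = D / R := rfl
  rw [hS, inner_eq_re_im, div_mul_eq_mul_div, div_le_iff₀ hR]
  simp only [Complex.sub_re, Complex.sub_im]
  set cr := (x.re - z.re) * (y.im - z.im) - (x.im - z.im) * (y.re - z.re)
  have hle : ε * cr ≤ |cr| := by
    calc ε * cr ≤ |ε * cr| := le_abs_self _
      _ = |cr| := by rw [abs_mul, hε, one_mul]
  have hle' := mul_le_mul_of_nonneg_right hle hR.le
  refine le_trans ?_ hle'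
  have : ε * cr * R - D * ((x.re - z.re) * (y.re - z.re) + (x.im - z.im) * (y.im - z.im)) =
      ε * R * k - D * (1 + m) + W := by
    rw [← hzw]
    linear_combination D * hz2
  linarith

lemma exists_arctan_le_angle {x y : ℂ} (hx : ‖x‖ < 1) (hy : ‖y‖ < 1) :
    ∃ z : ℂ, ‖z‖ = 1 ∧ Real.arctan (sinhHalfDist x y) ≤ EuclideanGeometry.angle x z y := by
  obtain ⟨z, hz, h⟩ := exists_sinhHalfDist_mul_inner_le hx hy
  refine ⟨z, hz, ?_⟩
  have hS := sinhHalfDist_nonneg x y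
  have hA : 0 < ‖x - z‖ := norm_pos_iff.2 (sub_ne_zero.2 fun h => by subst h; linarith)
  have hB : 0 < ‖y - z‖ := norm_pos_iff.2 (sub_ne_zero.2 fun h => by subst h; linarith)
  rw [← Real.arccos_cos (Real.arctan_nonneg.2 hS)
    (by linarith [Real.arctan_lt_pi_div_two (sinhHalfDist x y), Real.pi_pos])]
  unfold EuclideanGeometry.angle InnerProductGeometry.angle
  simp only [vsub_eq_sub]
  apply Real.arccos_le_arccos
  rw [Real.cos_arctan]
  rcases le_or_gt (inner ℝ (x - z) (y - z) : ℝ) 0 with hc | hc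
  · exact (div_nonpos_of_nonpos_of_nonneg hc (by positivity)).trans (by positivity)
  · rw [div_le_div_iff₀ (by positivity) (by positivity), one_mul]
    refine abs_le_of_sq_le_sq' ?_ (by positivity) |>.2
    rw [mul_pow, Real.sq_sqrt (by positivity), mul_pow, norm_sq_eq_re_im, norm_sq_eq_re_im]
    have h2 := pow_le_pow_left₀ (by positivity) h 2
    rw [sq_abs, mul_pow] at h2
    rw [inner_eq_re_im] at h2 ⊢
    nlinarith

lemma angle_le_visualAngleC {x y z : ℂ} (hz : ‖z‖ = 1) :
    EuclideanGeometry.angle x z y ≤ visualAngleC (Metric.ball 0 1) x y := by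
  refine le_csSup ⟨π, ?_⟩ ⟨z, ?_, rfl⟩
  · rintro _ ⟨w, -, rfl⟩
    exact EuclideanGeometry.angle_le_pi _ _ _
  · rw [frontier_ball _ one_ne_zero]
    simpa using hz

lemma visualAngleC_le {x y : ℂ} {b : ℝ}
    (h : ∀ z : ℂ, ‖z‖ = 1 → EuclideanGeometry.angle x z y ≤ b) :
    visualAngleC (Metric.ball 0 1) x y ≤ b := by
  unfold visualAngleC
  rw [frontier_ball _ one_ne_zero]
  refine csSup_le ⟨_, 1, by simp, rfl⟩ ?_
  rintro _ ⟨w, hw, rfl⟩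
  exact h w (by simpa using hw)

lemma one_sub_conj_mul_ne_zero {a x : ℂ} (ha : ‖a‖ < 1) (hx : ‖x‖ < 1) :
    1 - (starRingEnd ℂ) a * x ≠ 0 := by
  intro h
  have h1 : ‖(starRingEnd ℂ) a * x‖ = 1 := by rw [← sub_eq_zero.1 h, norm_one]
  rw [norm_mul, Complex.norm_conj] at h1
  nlinarith [norm_nonneg a, norm_nonneg x]

lemma one_sub_norm_discMoebius_sq {a x : ℂ} (ha : ‖a‖ < 1) (hx : ‖x‖ < 1) (θ : ℝ) :
    1 - ‖discMoebius a θ x‖ ^ 2 =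
      (1 - ‖a‖ ^ 2) * (1 - ‖x‖ ^ 2) / ‖1 - (starRingEnd ℂ) a * x‖ ^ 2 := by
  have h0 : ‖1 - (starRingEnd ℂ) a * x‖ ≠ 0 :=
    norm_ne_zero_iff.2 (one_sub_conj_mul_ne_zero ha hx)
  unfold discMoebius
  rw [norm_div, norm_mul, Complex.norm_exp_ofReal_mul_I, one_mul, div_pow,
    eq_div_iff (by positivity), sub_mul, div_mul_cancel₀ _ (by positivity)]
  simp only [norm_sq_eq_re_im, Complex.sub_re, Complex.sub_im, Complex.mul_re, Complex.mul_im,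
    Complex.conj_re, Complex.conj_im, Complex.one_re, Complex.one_im]
  ring

lemma norm_discMoebius_lt_one {a x : ℂ} (ha : ‖a‖ < 1) (hx : ‖x‖ < 1) (θ : ℝ) :
    ‖discMoebius a θ x‖ < 1 := by
  have h0 : 0 < ‖1 - (starRingEnd ℂ) a * x‖ :=
    norm_pos_iff.2 (one_sub_conj_mul_ne_zero ha hx)
  have h : 0 < 1 - ‖discMoebius a θ x‖ ^ 2 := by
    rw [one_sub_norm_discMoebius_sq ha hx]
    have := one_sub_norm_sq_pos ha
    have := one_sub_norm_sq_pos hx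
    positivity
  nlinarith [norm_nonneg (discMoebius a θ x)]

lemma norm_discMoebius_sub {a x y : ℂ} (ha : ‖a‖ < 1) (hx : ‖x‖ < 1) (hy : ‖y‖ < 1) (θ : ℝ) :
    ‖discMoebius a θ x - discMoebius a θ y‖ = (1 - ‖a‖ ^ 2) * ‖x - y‖ /
      (‖1 - (starRingEnd ℂ) a * x‖ * ‖1 - (starRingEnd ℂ) a * y‖) := by
  have hx0 := one_sub_conj_mul_ne_zero ha hx
  have hy0 := one_sub_conj_mul_ne_zero ha hy
  have e : discMoebius a θ x - discMoebius a θ y =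
      Complex.exp (θ * Complex.I) * ((1 - (starRingEnd ℂ) a * a) * (x - y)) /
        ((1 - (starRingEnd ℂ) a * x) * (1 - (starRingEnd ℂ) a * y)) := by
    unfold discMoebius
    rw [div_sub_div _ _ hx0 hy0]
    ring
  have ea : (1 - (starRingEnd ℂ) a * a) = ((1 - ‖a‖ ^ 2 : ℝ) : ℂ) := by
    rw [Complex.conj_mul']
    push_cast
    ring
  rw [e, ea, norm_div, norm_mul, norm_mul, norm_mul, Complex.norm_exp_ofReal_mul_I, one_mul,
    Complex.norm_real, Real.norm_of_nonneg (one_sub_norm_sq_pos ha).le]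

lemma sinhHalfDist_discMoebius {a x y : ℂ} (ha : ‖a‖ < 1) (hx : ‖x‖ < 1) (hy : ‖y‖ < 1)
    (θ : ℝ) :
    sinhHalfDist (discMoebius a θ x) (discMoebius a θ y) = sinhHalfDist x y := by
  rw [← sq_eq_sq₀ (sinhHalfDist_nonneg _ _) (sinhHalfDist_nonneg _ _),
    sinhHalfDist_sq (norm_discMoebius_lt_one ha hx θ) (norm_discMoebius_lt_one ha hy θ),
    sinhHalfDist_sq hx hy, one_sub_norm_discMoebius_sq ha hx, one_sub_norm_discMoebius_sq ha hy,
    norm_discMoebius_sub ha hx hy]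
  have h1 : ‖1 - (starRingEnd ℂ) a * x‖ ≠ 0 :=
    norm_ne_zero_iff.2 (one_sub_conj_mul_ne_zero ha hx)
  have h2 : ‖1 - (starRingEnd ℂ) a * y‖ ≠ 0 :=
    norm_ne_zero_iff.2 (one_sub_conj_mul_ne_zero ha hy)
  have h3 := (one_sub_norm_sq_pos ha).ne'
  have h4 := (one_sub_norm_sq_pos hx).ne'
  have h5 := (one_sub_norm_sq_pos hy).ne'
  generalize ‖1 - (starRingEnd ℂ) a * x‖ = p at *
  generalize ‖1 - (starRingEnd ℂ) a * y‖ = q at *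
  field_simp

lemma visualAngleC_discMoebius_le {a x y : ℂ} (ha : ‖a‖ < 1) (hx : ‖x‖ < 1) (hy : ‖y‖ < 1)
    (θ : ℝ) :
    visualAngleC (Metric.ball 0 1) (discMoebius a θ x) (discMoebius a θ y) ≤
      2 * visualAngleC (Metric.ball 0 1) x y := by
  obtain ⟨w, hw, h⟩ := exists_arctan_le_angle hx hy
  refine visualAngleC_le fun z hz => ?_
  have h1 := angle_le_two_mul_arctan (norm_discMoebius_lt_one ha hx θ)
    (norm_discMoebius_lt_one ha hy θ) hz
  rw [sinhHalfDist_discMoebius ha hx hy] at h1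
  linarith [angle_le_visualAngleC (x := x) (y := y) hw]

lemma visualAngleC_symmetric_le :
    visualAngleC (Metric.ball 0 1) ⟨0, 1 / 2⟩ ⟨0, -(1 / 2)⟩ ≤ Real.arccos (3 / 5) := by
  refine visualAngleC_le fun z hz => ?_
  have hz2 := norm_sq_eq_re_im z
  rw [hz] at hz2
  unfold EuclideanGeometry.angle InnerProductGeometry.angle
  simp only [vsub_eq_sub]
  apply Real.arccos_le_arccos
  have h1 : ‖(⟨0, 1 / 2⟩ : ℂ) - z‖ ^ 2 = 5 / 4 - z.im := by
    rw [norm_sq_eq_re_im]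
    simp only [Complex.sub_re, Complex.sub_im]
    linear_combination -hz2
  have h2 : ‖(⟨0, -(1 / 2)⟩ : ℂ) - z‖ ^ 2 = 5 / 4 + z.im := by
    rw [norm_sq_eq_re_im]
    simp only [Complex.sub_re, Complex.sub_im]
    linear_combination -hz2
  have hc : inner ℝ ((⟨0, 1 / 2⟩ : ℂ) - z) (⟨0, -(1 / 2)⟩ - z) = 3 / 4 := by
    rw [inner_eq_re_im]
    simp only [Complex.sub_re, Complex.sub_im]
    linear_combination -hz2
  have hy : z.im ^ 2 ≤ 1 := by nlinarith [sq_nonneg z.re]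
  have hy' := abs_le_of_sq_le_sq' (a := z.im) (b := 1) (by simpa using hy) zero_le_one
  rw [hc]
  set A := ‖(⟨0, 1 / 2⟩ : ℂ) - z‖
  set B := ‖(⟨0, -(1 / 2)⟩ : ℂ) - z‖
  have hA : 0 < A := lt_of_le_of_ne (norm_nonneg _) fun h => by
    rw [← h] at h1; linarith [hy'.2]
  have hB : 0 < B := lt_of_le_of_ne (norm_nonneg _) fun h => by
    rw [← h] at h2; linarith [hy'.1]
  rw [le_div_iff₀ (by positivity)]
  nlinarith [sq_nonneg (A - B)]

lemma arccos_neg_seven_div : Real.arccos (-(7 / 25)) = 2 * Real.arccos (3 / 5) := by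
  have h0 := Real.arccos_nonneg (3 / 5)
  have h1 : Real.arccos (3 / 5) ≤ π / 2 := Real.arccos_le_pi_div_two.2 (by norm_num)
  rw [← Real.arccos_cos (x := 2 * Real.arccos (3 / 5)) (by linarith) (by linarith),
    Real.cos_two_mul, Real.cos_arccos (by norm_num) (by norm_num)]
  norm_num

lemma discMoebius_neg_ofReal {t s : ℝ} (hs : 1 + s ^ 2 * t ^ 2 ≠ 0) :
    discMoebius ((-t : ℝ) : ℂ) 0 ⟨0, s⟩ =
      ⟨t * (1 + s ^ 2) / (1 + s ^ 2 * t ^ 2), s * (1 - t ^ 2) / (1 + s ^ 2 * t ^ 2)⟩ := by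
  have hs' : (1 : ℂ) - (starRingEnd ℂ) ((-t : ℝ) : ℂ) * ⟨0, s⟩ ≠ 0 := by
    intro h
    have := congrArg Complex.re h
    simp at this
  unfold discMoebius
  rw [div_eq_iff hs']
  apply Complex.ext
  · simp
    field_simp
    ring
  · simp
    field_simp
    ring

lemma angle_discMoebius_neg_ofReal {t : ℝ} (ht : |t| < 1) :
    EuclideanGeometry.angle (discMoebius ((-t : ℝ) : ℂ) 0 ⟨0, 1 / 2⟩) 1
      (discMoebius ((-t : ℝ) : ℂ) 0 ⟨0, -(1 / 2)⟩) =
      Real.arccos (((4 - t) ^ 2 - 4 * (1 + t) ^ 2) / ((4 - t) ^ 2 + 4 * (1 + t) ^ 2)) := by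
  have hlt := abs_lt.1 ht
  rw [discMoebius_neg_ofReal (by positivity), discMoebius_neg_ofReal (by positivity)]
  unfold EuclideanGeometry.angle InnerProductGeometry.angle
  simp only [vsub_eq_sub]
  congr 1
  set g := (1 - t) / (4 + t ^ 2) with hg
  have hg0 : g ≠ 0 := (div_pos (by linarith) (by positivity)).ne'
  have e1 : (⟨t * (1 + (1 / 2) ^ 2) / (1 + (1 / 2) ^ 2 * t ^ 2),
      1 / 2 * (1 - t ^ 2) / (1 + (1 / 2) ^ 2 * t ^ 2)⟩ : ℂ) - 1 =
      ⟨-(g * (4 - t)), g * (2 * (1 + t))⟩ := by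
    apply Complex.ext
    · simp [hg]
      field_simp
      ring
    · simp [hg]
      field_simp
      ring
  have e2 : (⟨t * (1 + (-(1 / 2)) ^ 2) / (1 + (-(1 / 2)) ^ 2 * t ^ 2),
      -(1 / 2) * (1 - t ^ 2) / (1 + (-(1 / 2)) ^ 2 * t ^ 2)⟩ : ℂ) - 1 =
      ⟨-(g * (4 - t)), -(g * (2 * (1 + t)))⟩ := by
    apply Complex.ext
    · simp [hg]
      field_simp
      ring
    · simp [hg]
      field_simp
      ring
  rw [e1, e2]
  have hn : ‖(⟨-(g * (4 - t)), -(g * (2 * (1 + t)))⟩ : ℂ)‖ =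
      ‖(⟨-(g * (4 - t)), g * (2 * (1 + t))⟩ : ℂ)‖ := by
    rw [← sq_eq_sq₀ (norm_nonneg _) (norm_nonneg _), norm_sq_eq_re_im, norm_sq_eq_re_im]
    simp
  rw [hn, ← sq, norm_sq_eq_re_im, inner_eq_re_im]
  have h4 : (4 - t) ^ 2 + 4 * (1 + t) ^ 2 ≠ 0 := by
    have : 0 < 4 - t := by linarith
    positivity
  rw [show (-(g * (4 - t))) ^ 2 + (g * (2 * (1 + t))) ^ 2 =
      g ^ 2 * ((4 - t) ^ 2 + 4 * (1 + t) ^ 2) by ring,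
    show -(g * (4 - t)) * -(g * (4 - t)) + g * (2 * (1 + t)) * -(g * (2 * (1 + t))) =
      g ^ 2 * ((4 - t) ^ 2 - 4 * (1 + t) ^ 2) by ring,
    mul_div_mul_left _ _ (pow_ne_zero 2 hg0)]

lemma exists_lt_angle_discMoebius {b : ℝ} (hb : b < 2 * Real.arccos (3 / 5)) :
    ∃ t : ℝ, |t| < 1 ∧
      b < EuclideanGeometry.angle (discMoebius ((-t : ℝ) : ℂ) 0 ⟨0, 1 / 2⟩) 1
        (discMoebius ((-t : ℝ) : ℂ) 0 ⟨0, -(1 / 2)⟩) := by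
  have hcont : ContinuousAt (fun t : ℝ =>
      Real.arccos (((4 - t) ^ 2 - 4 * (1 + t) ^ 2) / ((4 - t) ^ 2 + 4 * (1 + t) ^ 2))) 1 := by
    refine Real.continuous_arccos.continuousAt.comp (ContinuousAt.div ?_ ?_ (by norm_num))
    · fun_prop
    · fun_prop
  have hev := hcont.eventually_const_lt (u := b) (by
    refine hb.trans_eq (arccos_neg_seven_div.symm.trans ?_)
    norm_num)
  obtain ⟨δ, hδ, h⟩ := Metric.eventually_nhds_iff.1 hev
  have hm0 : 0 < min δ 1 := lt_min hδ one_pos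
  have hm1 := min_le_left δ 1
  have hm2 := min_le_right δ 1
  have ht : |1 - min δ 1 / 2| < 1 := by rw [abs_lt]; constructor <;> linarith
  refine ⟨1 - min δ 1 / 2, ht, ?_⟩
  rw [angle_discMoebius_neg_ofReal ht]
  apply h
  rw [Real.dist_eq, abs_lt]
  constructor <;> linarith

theorem stmt2 :
    (∀ a ∈ Metric.ball (0 : ℂ) 1, ∀ θ : ℝ,
      ∀ x ∈ Metric.ball (0 : ℂ) 1, ∀ y ∈ Metric.ball (0 : ℂ) 1,
        visualAngleC (Metric.ball 0 1) (discMoebius a θ x) (discMoebius a θ y) ≤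
          2 * visualAngleC (Metric.ball 0 1) x y) ∧
    (∀ c : ℝ, c < 2 →
      ∃ a ∈ Metric.ball (0 : ℂ) 1, ∃ θ : ℝ,
        ∃ x ∈ Metric.ball (0 : ℂ) 1, ∃ y ∈ Metric.ball (0 : ℂ) 1,
          x ≠ y ∧
            c * visualAngleC (Metric.ball 0 1) x y <
              visualAngleC (Metric.ball 0 1) (discMoebius a θ x) (discMoebius a θ y)) := by
  constructor
  · intro a ha θ x hx y hy
    rw [mem_ball_zero_iff] at ha hx hy
    exact visualAngleC_discMoebius_le ha hx hy θ
  · intro c hc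
    have hpos : 0 < Real.arccos (3 / 5) := Real.arccos_pos.2 (by norm_num)
    have hv0 : 0 ≤ visualAngleC (Metric.ball 0 1) ⟨0, 1 / 2⟩ ⟨0, -(1 / 2)⟩ :=
      (EuclideanGeometry.angle_nonneg _ _ _).trans (angle_le_visualAngleC (z := 1) (by simp))
    have hv := visualAngleC_symmetric_le
    have hb : c * visualAngleC (Metric.ball 0 1) ⟨0, 1 / 2⟩ ⟨0, -(1 / 2)⟩ <
        2 * Real.arccos (3 / 5) := by
      rcases le_or_gt c 0 with h | h
      · nlinarith
      · nlinarith
    obtain ⟨t, ht, h⟩ := exists_lt_angle_discMoebius hb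
    have hmem (s : ℝ) (hs : s ^ 2 = 1 / 4) : (⟨0, s⟩ : ℂ) ∈ Metric.ball (0 : ℂ) 1 := by
      have h := norm_sq_eq_re_im ⟨0, s⟩
      simp only at h
      rw [mem_ball_zero_iff]
      nlinarith [norm_nonneg (⟨0, s⟩ : ℂ)]
    refine ⟨((-t : ℝ) : ℂ), by simpa using ht, 0, ⟨0, 1 / 2⟩, hmem _ (by norm_num),
      ⟨0, -(1 / 2)⟩, hmem _ (by norm_num), ?_, h.trans_le (angle_le_visualAngleC (by simp))⟩
    intro h
    have := congrArg Complex.im h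
    norm_num at this
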